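/- For s ∈ ℝ and ε > 0, define λ₋^s(ξ') = (ξ₁ + i√(|ξ''|² + ε²))^s for ξ' = (ξ₁, ξ'') ∈ ℝ × ℝ^{n-2}, using the principal branch of z^s. Then ξ' ↦ λ₋^s(ξ') extends holomorphically in the variable ξ₁ to the upper half plane {Im ξ₁ > 0}, and its modulus there is bounded by (|ξ₁| + Im ξ₁ + √(|ξ''|² + ε²))^{|s|} up to a multiplicative constant; consequently (by Paley–Wiener theory) λ₋^s is the Fourier transform (in x₁) of a distribution supported in {x₁ ≤ 0}. -/

import Mathlib

/-- The symbol `λ₋^s`, extended to complex `ξ₁`. -/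
noncomputable def lamMinus (s ε : ℝ) {m : ℕ} (ξ'' : EuclideanSpace ℝ (Fin m)) (z : ℂ) : ℂ :=
  (z + Complex.I * (Real.sqrt (‖ξ''‖^2 + ε^2) : ℂ)) ^ (s : ℂ)

namespace Stmt9Aux

open MeasureTheory ProbabilityTheory Filter Topology Set

lemma aux_int (σ a : ℝ) (hσ : 0 < σ) (ha : 0 < a) :
    Integrable (gammaPDFReal σ a) ∧ ∫ x, gammaPDFReal σ a x = 1 := by
  have h := lintegral_gammaPDF_eq_one hσ ha
  have hn : 0 ≤ᵐ[volume] gammaPDFReal σ a := ae_of_all _ (gammaPDFReal_nonneg hσ ha)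
  have hm := (measurable_gammaPDFReal σ a).aestronglyMeasurable (μ := volume)
  constructor
  · refine ⟨hm, ?_⟩
    rw [hasFiniteIntegral_iff_ofReal hn]
    change ∫⁻ x, gammaPDF σ a x < _
    rw [h]; simp
  · rw [integral_eq_lintegral_of_nonneg_ae hn hm]
    change (∫⁻ x, gammaPDF σ a x).toReal = _
    rw [h]; simp

lemma aux_tilt (σ a x : ℝ) (ha : 0 < a) (hx : x < a) (y : ℝ) :
    gammaPDFReal σ a y * Real.exp (x * y) = a ^ σ * (a - x) ^ (-σ) * gammaPDFReal σ (a - x) y := by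
  unfold gammaPDFReal
  split_ifs
  · have h1 : Real.exp (-((a - x) * y)) = Real.exp (-(a * y)) * Real.exp (x * y) := by
      rw [← Real.exp_add]; ring_nf
    have h2 : (a - x) ^ (-σ) * (a - x) ^ σ = 1 := by
      rw [← Real.rpow_add (by linarith)]; simp
    rw [h1]
    linear_combination (- a ^ σ / Real.Gamma σ * y ^ (σ - 1) * Real.exp (-(a * y)) * Real.exp (x * y)) * h2
  · simp

lemma aux_mgf (σ a x : ℝ) (hσ : 0 < σ) (ha : 0 < a) (hx : x < a) :
    Integrable (fun y => Real.exp (x * y)) (gammaMeasure σ a) ∧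
      mgf id (gammaMeasure σ a) x = a ^ σ * (a - x) ^ (-σ) := by
  have hm : Measurable (gammaPDF σ a) := (measurable_gammaPDFReal σ a).ennreal_ofReal
  have hlt : ∀ᵐ y, gammaPDF σ a y < ⊤ := ae_of_all _ fun y => by simp [gammaPDF]
  have htr : ∀ y, (gammaPDF σ a y).toReal = gammaPDFReal σ a y := fun y => by
    simp [gammaPDF, gammaPDFReal_nonneg hσ ha]
  obtain ⟨h1, h2⟩ := aux_int σ (a - x) hσ (by linarith)
  constructor
  · rw [gammaMeasure, integrable_withDensity_iff_integrable_smul' hm hlt]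
    simp only [htr, smul_eq_mul, aux_tilt σ a x ha hx]
    exact h1.const_mul _
  · rw [mgf, gammaMeasure, integral_withDensity_eq_integral_toReal_smul hm hlt]
    simp only [htr, smul_eq_mul, id, aux_tilt σ a x ha hx]
    rw [integral_const_mul, h2, mul_one]

lemma aux_cmgf (σ a : ℝ) (hσ : 0 < σ) (ha : 0 < a) (z : ℂ) (hz : z.re < a) :
    complexMGF id (gammaMeasure σ a) z = (a : ℂ) ^ (σ : ℂ) * ((a : ℂ) - z) ^ (-σ : ℂ) := by
  have hsub : Iio a ⊆ interior (integrableExpSet id (gammaMeasure σ a)) :=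
    interior_maximal (fun x hx => (aux_mgf σ a x hσ ha hx).1) isOpen_Iio
  have hU : IsOpen {z : ℂ | z.re < a} := isOpen_lt Complex.continuous_re continuous_const
  have h1 : AnalyticOnNhd ℂ (complexMGF id (gammaMeasure σ a)) {z : ℂ | z.re < a} :=
    analyticOnNhd_complexMGF.mono fun z hz => hsub hz
  have h2 : AnalyticOnNhd ℂ (fun z : ℂ => (a : ℂ) ^ (σ : ℂ) * ((a : ℂ) - z) ^ (-σ : ℂ))
      {z : ℂ | z.re < a} := by
    refine DifferentiableOn.analyticOnNhd (fun w hw => ?_) hU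
    refine DifferentiableAt.differentiableWithinAt ?_
    refine DifferentiableAt.const_mul (DifferentiableAt.cpow_const (by fun_prop) ?_) _
    left
    simpa using hw
  have hc : Convex ℝ {z : ℂ | z.re < a} := convex_halfSpace_re_lt a
  refine h1.eqOn_of_preconnected_of_frequently_eq h2 hc.isPreconnected (z₀ := 0) (by simpa) ?_ hz
  have ht : Tendsto (fun x : ℝ => (x : ℂ)) (𝓝[≠] 0) (𝓝[≠] 0) := by
    refine tendsto_nhdsWithin_iff.2 ⟨?_, ?_⟩
    · exact (Complex.continuous_ofReal.tendsto' 0 0 (by simp)).mono_left nhdsWithin_le_nhds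
    · filter_upwards [self_mem_nhdsWithin] with x hx
      simpa using hx
  refine ht.frequently (Eventually.frequently ?_)
  filter_upwards [nhdsWithin_le_nhds (Iio_mem_nhds ha)] with x hx
  have hx' : x < a := hx
  rw [complexMGF_ofReal, (aux_mgf σ a x hσ ha hx).2, ← Complex.ofReal_sub, ← Complex.ofReal_neg,
    ← Complex.ofReal_cpow ha.le, ← Complex.ofReal_cpow (by linarith)]
  push_cast; rfl

lemma aux_rot (s a t : ℝ) (ha : 0 < a) :
    ((t : ℂ) + Complex.I * a) ^ (s : ℂ) = Complex.I ^ (s : ℂ) * ((a : ℂ) - t * Complex.I) ^ (s : ℂ) := by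
  have h0 : ((a : ℂ) - t * Complex.I) ≠ 0 := fun h => by
    have := congrArg Complex.re h
    simp at this; exact ha.ne' this
  have h1 : (t : ℂ) + Complex.I * a = Complex.I * ((a : ℂ) - t * Complex.I) := by
    linear_combination (t : ℂ) * Complex.I_mul_I
  have harg : |Complex.arg ((a : ℂ) - t * Complex.I)| < Real.pi / 2 := by
    rw [Complex.abs_arg_lt_pi_div_two_iff]; left; simpa
  rw [abs_lt] at harg
  have hl : Complex.log (Complex.I * ((a : ℂ) - t * Complex.I)) =
      Complex.log Complex.I + Complex.log ((a : ℂ) - t * Complex.I) := by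
    rw [Complex.log_mul_eq_add_log_iff Complex.I_ne_zero h0, Complex.arg_I]
    constructor <;> linarith
  rw [h1, Complex.cpow_def_of_ne_zero (mul_ne_zero Complex.I_ne_zero h0),
    Complex.cpow_def_of_ne_zero Complex.I_ne_zero, Complex.cpow_def_of_ne_zero h0, hl, add_mul,
    Complex.exp_add]

lemma aux_lam (s a : ℝ) (hs : s < 0) (ha : 0 < a) : ∃ c : ℂ, ∀ t : ℝ,
    ((t : ℂ) + Complex.I * a) ^ (s : ℂ) =
      c * ∫ y : ℝ, Complex.exp (t * Complex.I * y) ∂(gammaMeasure (-s) a) := by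
  refine ⟨Complex.I ^ (s : ℂ) * (a : ℂ) ^ (s : ℂ), fun t => ?_⟩
  have h := aux_cmgf (-s) a (by linarith) ha (t * Complex.I) (by simpa)
  rw [complexMGF] at h
  simp only [id] at h
  rw [h, aux_rot s a t ha]
  have h2 : (a : ℂ) ^ (s : ℂ) * (a : ℂ) ^ ((-s : ℝ) : ℂ) = 1 := by
    rw [← Complex.cpow_add _ _ (by exact_mod_cast ha.ne')]; simp
  have h3 : (-((-s : ℝ) : ℂ)) = (s : ℂ) := by simp
  rw [h3]
  linear_combination (-Complex.I ^ (s : ℂ) * ((a : ℂ) - t * Complex.I) ^ (s : ℂ)) * h2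

open FourierTransform SchwartzMap in
lemma aux_neg (s a : ℝ) (hs : s < 0) (ha : 0 < a) (f : SchwartzMap ℝ ℂ)
    (hf : ∀ x : ℝ, x ≤ 0 → f x = 0) :
    ∫ t : ℝ, ((t : ℂ) + Complex.I * a) ^ (s : ℂ) * (𝓕⁻ f) t = 0 := by
  obtain ⟨c, hc⟩ := aux_lam s a hs ha
  set μ := gammaMeasure (-s) a with hμ
  have : IsProbabilityMeasure μ := isProbabilityMeasure_gammaMeasure (by linarith) ha
  simp_rw [hc, mul_assoc, integral_const_mul, ← integral_mul_const]
  rw [integral_integral_swap]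
  · have : ∀ᵐ (y : ℝ) ∂μ, ∫ t : ℝ, Complex.exp (t * (Complex.I * y)) * (𝓕⁻ f) t = 0 := by
      have hpos : ∀ᵐ y ∂μ, 0 ≤ y := by
        have hm : Measurable (gammaPDF (-s) a) := (measurable_gammaPDFReal _ a).ennreal_ofReal
        rw [hμ, gammaMeasure, ae_withDensity_iff hm]
        refine ae_of_all _ fun y hy => ?_
        by_contra h
        exact hy (gammaPDF_of_neg (not_le.1 h))
      filter_upwards [hpos] with y hy
      have h1 : (𝓕 (𝓕⁻ f)) (-(y / (2 * Real.pi))) = 0 := by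
        rw [FourierTransform.fourier_fourierInv_eq]
        exact hf _ (by simp only [Left.neg_nonpos_iff]; positivity)
      rw [SchwartzMap.fourier_coe, Real.fourier_real_eq_integral_exp_smul] at h1
      rw [← h1]
      congr 1
      ext t
      rw [smul_eq_mul]
      congr 2
      have : (Real.pi : ℂ) ≠ 0 := by exact_mod_cast Real.pi_ne_zero
      push_cast
      field_simp
    rw [integral_congr_ae this]; simp
  · have h2 : Integrable (fun p : ℝ × ℝ => (𝓕⁻ f) p.1) (volume.prod μ) :=
      (𝓕⁻ f).integrable.comp_fst μ
    refine h2.bdd_mul (c := 1) (Continuous.aestronglyMeasurable (by fun_prop)) (ae_of_all _ fun p => ?_)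
    rw [Complex.norm_exp]
    simp

lemma aux_int_bdd (F : ℝ → ℂ) (hF : Continuous F) (K : ℝ) (N : ℕ)
    (hK : ∀ t, ‖F t‖ ≤ K * (1 + |t|) ^ N) (f : SchwartzMap ℝ ℂ) :
    ∀ t, ‖F t * f t‖ ≤ (1 + ‖t‖) ^ (-(2 : ℝ)) * (K * 2 ^ (N + 2) *
      (Finset.Iic (N + 2, 0)).sup (schwartzSeminormFamily ℂ ℝ ℂ) f) := by
  intro t
  have h := SchwartzMap.one_add_le_sup_seminorm_apply (𝕜 := ℂ) (m := (N + 2, 0)) (k := N + 2) (n := 0)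
    le_rfl le_rfl f t
  rw [norm_iteratedFDeriv_zero] at h
  have hK0 : 0 ≤ K := by
    have := (norm_nonneg _).trans (hK 0)
    simpa using this
  rw [Real.rpow_neg (by positivity), ← div_eq_inv_mul, le_div_iff₀' (by positivity), norm_mul]
  calc (1 + ‖t‖) ^ (2 : ℝ) * (‖F t‖ * ‖f t‖) 
      ≤ (1 + ‖t‖) ^ (2 : ℝ) * ((K * (1 + |t|) ^ N) * ‖f t‖) := mul_le_mul_of_nonneg_left (mul_le_mul_of_nonneg_right (hK t) (norm_nonneg _)) (by positivity)
    _ = K * ((1 + ‖t‖) ^ (N + 2) * ‖f t‖) := by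
        rw [Real.rpow_ofNat, Real.norm_eq_abs]; ring
    _ ≤ K * (2 ^ (N + 2) * _) := mul_le_mul_of_nonneg_left h hK0
    _ = _ := by unfold schwartzSeminormFamily; ring

lemma aux_dec : Integrable (fun t : ℝ => (1 + ‖t‖) ^ (-(2 : ℝ))) :=
  integrable_one_add_norm (by simp)

lemma aux_integrable (F : ℝ → ℂ) (hF : Continuous F) (K : ℝ) (N : ℕ)
    (hK : ∀ t, ‖F t‖ ≤ K * (1 + |t|) ^ N) (f : SchwartzMap ℝ ℂ) :
    Integrable (fun t => F t * f t) :=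
  (aux_dec.mul_const _).mono' (hF.mul f.continuous).aestronglyMeasurable
    (ae_of_all _ (aux_int_bdd F hF K N hK f))

lemma aux_CLM (F : ℝ → ℂ) (hF : Continuous F) (K : ℝ) (N : ℕ)
    (hK : ∀ t, ‖F t‖ ≤ K * (1 + |t|) ^ N) :
    ∃ T : SchwartzMap ℝ ℂ →L[ℂ] ℂ, ∀ f, T f = ∫ t, F t * f t := by
  have hK0 : 0 ≤ K := by
    have := (norm_nonneg _).trans (hK 0)
    simpa using this
  refine ⟨SchwartzMap.mkCLMtoNormedSpace (fun f => ∫ t, F t * f t) ?_ ?_ ?_, fun f => rfl⟩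
  · intro f g
    simp only [_root_.add_apply, mul_add]
    exact integral_add (aux_integrable F hF K N hK f) (aux_integrable F hF K N hK g)
  · intro c f
    simp only [_root_.smul_apply, smul_eq_mul, RingHom.id_apply]
    rw [← integral_const_mul]
    congr 1; ext t; ring
  · refine ⟨Finset.Iic (N + 2, 0), (∫ t : ℝ, (1 + ‖t‖) ^ (-(2 : ℝ))) * (K * 2 ^ (N + 2)),
      by positivity, fun f => ?_⟩
    refine (norm_integral_le_of_norm_le (aux_dec.mul_const _)
      (ae_of_all _ (aux_int_bdd F hF K N hK f))).trans ?_
    rw [integral_mul_const]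
    exact le_of_eq (by ring)

open FourierTransform SchwartzMap LineDeriv in
lemma aux_step (a : ℝ) (f : SchwartzMap ℝ ℂ)
    (hf : ∀ x : ℝ, x ≤ 0 → f x = 0) :
    ∃ h : SchwartzMap ℝ ℂ, (∀ x : ℝ, x ≤ 0 → h x = 0) ∧
      ∀ t : ℝ, (𝓕⁻ h) t = ((t : ℂ) + Complex.I * a) * (𝓕⁻ f) t := by
  refine ⟨(-(2 * Real.pi * Complex.I))⁻¹ • (∂_{(1 : ℝ)} f) + (Complex.I * a) • f, ?_, ?_⟩
  · intro x hx
    have h1 : deriv f x = 0 := by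
      have hd : HasDerivWithinAt f (deriv f x) (Iic x) x :=
        f.differentiableAt.hasDerivAt.hasDerivWithinAt
      have h0 : HasDerivWithinAt f 0 (Iic x) x :=
        (hasDerivWithinAt_const x (Iic x) (0 : ℂ)).congr (fun y hy => hf y (le_trans hy hx)) (hf x hx)
      exact (uniqueDiffWithinAt_Iic x).eq_deriv _ hd h0
    have h2 : (∂_{(1 : ℝ)} f) x = deriv f x := by
      rw [SchwartzMap.lineDerivOp_apply_eq_fderiv]; simp
    simp [h2, h1, hf x hx]
  · intro t
    have : (fun x : ℝ => inner ℝ x (1 : ℝ)).HasTemperateGrowth := by fun_prop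
    rw [FourierTransform.fourierInv_add, FourierTransform.fourierInv_smul,
      FourierTransform.fourierInv_smul, SchwartzMap.fourierInv_lineDerivOp_eq]
    simp only [_root_.add_apply, _root_.smul_apply, smulLeftCLM_apply_apply this]
    have : (Real.pi : ℂ) ≠ 0 := by exact_mod_cast Real.pi_ne_zero
    simp
    field_simp
    linear_combination (-(𝓕⁻ f) t * t) * Complex.I_mul_I

lemma aux_bound (s a : ℝ) (ha : 0 < a) (z : ℂ) (hz : 0 ≤ z.im) :
    ‖(z + Complex.I * a) ^ (s : ℂ)‖ ≤ (1 + a ^ (s - |s|)) * (|z.re| + z.im + a) ^ |s| := by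
  rw [Complex.norm_cpow_real]
  set w := z + Complex.I * a with hw
  have hre : w.re = z.re := by simp [hw]
  have him : w.im = z.im + a := by simp [hw]
  have h1 : ‖w‖ ≤ |z.re| + z.im + a := by
    have := Complex.norm_le_abs_re_add_abs_im w
    rw [hre, him, abs_of_pos (by linarith : 0 < z.im + a)] at this; linarith
  have h2 : a ≤ ‖w‖ := by
    have := Complex.abs_im_le_norm w
    rw [him, abs_of_pos (by linarith : 0 < z.im + a)] at this; linarith
  have hR : 0 ≤ (|z.re| + z.im + a) ^ |s| := by positivity
  have hA : 0 ≤ a ^ (s - |s|) := by positivity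
  rcases le_or_gt 0 s with hs | hs
  · rw [abs_of_nonneg hs] at *
    have := Real.rpow_le_rpow (norm_nonneg w) h1 hs
    nlinarith
  · have h3 : ‖w‖ ^ s ≤ a ^ s := Real.rpow_le_rpow_of_nonpos ha h2 hs.le
    have h4 : a ^ s = a ^ (s - |s|) * a ^ |s| := by rw [← Real.rpow_add ha]; ring_nf
    have h5 : a ^ |s| ≤ (|z.re| + z.im + a) ^ |s| :=
      Real.rpow_le_rpow ha.le (h2.trans h1) (abs_nonneg s)
    have := mul_le_mul_of_nonneg_left h5 hA
    nlinarith

lemma aux_ne (a : ℝ) (ha : 0 < a) (z : ℂ) (hz : 0 ≤ z.im) :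
    (z + Complex.I * a) ∈ Complex.slitPlane := by
  right
  have : (z + Complex.I * a).im = z.im + a := by simp
  rw [this]; linarith

lemma aux_cont (s a : ℝ) (ha : 0 < a) :
    Continuous (fun t : ℝ => ((t : ℂ) + Complex.I * a) ^ (s : ℂ)) := by
  refine Continuous.cpow (by fun_prop) continuous_const fun t => ?_
  exact aux_ne a ha t (by simp)

lemma aux_growth (s a : ℝ) (ha : 0 < a) :
    ∃ (K : ℝ) (N : ℕ), ∀ t : ℝ, ‖((t : ℂ) + Complex.I * a) ^ (s : ℂ)‖ ≤ K * (1 + |t|) ^ N := by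
  obtain ⟨N, hN⟩ := exists_nat_ge |s|
  refine ⟨(1 + a ^ (s - |s|)) * (1 + a) ^ N, N, fun t => ?_⟩
  refine (aux_bound s a ha t (by simp)).trans ?_
  rw [mul_assoc, ← mul_pow]
  refine mul_le_mul_of_nonneg_left ?_ (by positivity)
  simp only [Complex.ofReal_re, Complex.ofReal_im, add_zero]
  have h0 : 0 ≤ |t| := abs_nonneg t
  have h1 : |t| + a ≤ (1 + a) * (1 + |t|) := by nlinarith [mul_nonneg ha.le h0]
  have h2 : 1 ≤ (1 + a) * (1 + |t|) := by nlinarith [mul_nonneg ha.le h0]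
  calc (|t| + a) ^ |s| ≤ ((1 + a) * (1 + |t|)) ^ |s| :=
        Real.rpow_le_rpow (by positivity) h1 (abs_nonneg s)
    _ ≤ ((1 + a) * (1 + |t|)) ^ (N : ℝ) := Real.rpow_le_rpow_of_exponent_le h2 hN
    _ = _ := Real.rpow_natCast _ _

open FourierTransform SchwartzMap in
lemma aux_all (a : ℝ) (ha : 0 < a) (n : ℕ) : ∀ s : ℝ, s < n → ∀ f : SchwartzMap ℝ ℂ,
    (∀ x : ℝ, x ≤ 0 → f x = 0) →
    ∫ t : ℝ, ((t : ℂ) + Complex.I * a) ^ (s : ℂ) * (𝓕⁻ f) t = 0 := by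
  induction n with
  | zero => exact fun s hs f hf => aux_neg s a (by simpa using hs) ha f hf
  | succ n ih =>
    intro s hs f hf
    obtain ⟨h, hh, hF⟩ := aux_step a f hf
    rw [← ih (s - 1) (by push_cast at hs; linarith) h hh]
    congr 1
    ext t
    rw [hF]
    have h0 := Complex.slitPlane_ne_zero (aux_ne a ha t (by simp))
    push_cast
    rw [Complex.cpow_sub _ _ h0, Complex.cpow_one]
    field_simp

end Stmt9Aux

open Stmt9Aux in
theorem stmt9 {m : ℕ} (s ε : ℝ) (hε : 0 < ε) (ξ'' : EuclideanSpace ℝ (Fin m)) :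
    DifferentiableOn ℂ (lamMinus s ε ξ'') {z : ℂ | 0 ≤ z.im} ∧
    (∃ C > 0, ∀ z : ℂ, 0 ≤ z.im →
      ‖lamMinus s ε ξ'' z‖
        ≤ C * (|z.re| + z.im + Real.sqrt (‖ξ''‖^2 + ε^2)) ^ |s|) ∧
    (∃ T : SchwartzMap ℝ ℂ →L[ℂ] ℂ,
      (∀ f : SchwartzMap ℝ ℂ, (∀ x : ℝ, x ≤ 0 → f x = 0) → T f = 0) ∧
      (∀ f : SchwartzMap ℝ ℂ,
        T (SchwartzMap.fourierTransformCLM ℂ f)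
          = ∫ t : ℝ, lamMinus s ε ξ'' (t : ℂ) * f t)) := by
  set a := Real.sqrt (‖ξ''‖^2 + ε^2) with ha_def
  have ha : 0 < a := Real.sqrt_pos.2 (by positivity)
  have hlam : ∀ z, lamMinus s ε ξ'' z = (z + Complex.I * (a : ℂ)) ^ (s : ℂ) := fun z => rfl
  refine ⟨?_, ⟨1 + a ^ (s - |s|), by positivity, fun z hz => ?_⟩, ?_⟩
  · intro z hz
    refine DifferentiableAt.differentiableWithinAt ?_
    have : lamMinus s ε ξ'' = fun z : ℂ => (z + Complex.I * (a : ℂ)) ^ (s : ℂ) := funext hlam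
    rw [this]
    exact DifferentiableAt.cpow_const (by fun_prop) (aux_ne a ha z hz)
  · rw [hlam]
    exact aux_bound s a ha z hz
  · obtain ⟨K, N, hK⟩ := aux_growth s a ha
    obtain ⟨T, hT⟩ := aux_CLM _ (aux_cont s a ha) K N hK
    refine ⟨T ∘L (FourierTransform.fourierInvCLM ℂ (SchwartzMap ℝ ℂ)), ?_, ?_⟩
    · intro f hf
      obtain ⟨n, hn⟩ := exists_nat_gt s
      rw [ContinuousLinearMap.comp_apply, hT]
      exact aux_all a ha n s hn f hf
    · intro f
      rw [ContinuousLinearMap.comp_apply, hT, SchwartzMap.fourierTransformCLM_apply,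
        FourierTransform.fourierInvCLM_apply, FourierTransform.fourierInv_fourier_eq]
      rfl
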